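/- arXiv:math/0607275 — 5 statements merged into one kernel-verified Lean document; each statement's English description precedes it below -/
import Mathlib

section
/- Let ℋ be a complex Hilbert space, H a bounded self-adjoint operator on ℋ, W a bounded, self-adjoint, injective operator on ℋ, and I ⊆ ℝ a compact interval. Then the limiting absorption principle for H relative to (I, W) fails — i.e. it is NOT the case that sup{‖W (H − z)^{-1} W‖ : Re z ∈ I, Im z ≠ 0} < ∞ — if and only if there exists a special sequence for H relative to (I, W) whose mass η is strictly positive. -/
open Filter

/-- A *special sequence* `(f n, z n)` for the bounded operator `H` relative to
`(I, W)`, with mass `η`. -/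
def IsSpecialSequence {E : Type*} [NormedAddCommGroup E] [InnerProductSpace ℂ E]
    (H W : E →L[ℂ] E) (I : Set ℝ) (f : ℕ → E) (z : ℕ → ℂ) (η : ℝ) : Prop :=
  0 ≤ η ∧ ∃ lam ∈ I,
    (∀ n, (z n).re ∈ I) ∧
    Tendsto (fun n => (z n).re) atTop (nhds lam) ∧
    (∀ n, (z n).im ≠ 0) ∧
    Tendsto (fun n => (z n).im) atTop (nhds 0) ∧
    Tendsto (fun n => ‖W (f n)‖) atTop (nhds η) ∧
    ∃ u : ℕ → E, (∀ n, W (u n) = H (f n) - z n • f n) ∧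
      Tendsto (fun n => ‖u n‖) atTop (nhds 0)

namespace ContinuousLinearMap

variable {E : Type*} [NormedAddCommGroup E] [InnerProductSpace ℂ E] [CompleteSpace E]

theorem abs_im_mul_norm_le_of_isSelfAdjoint {H : E →L[ℂ] E} (hH : IsSelfAdjoint H) (z : ℂ)
    (x : E) : |z.im| * ‖x‖ ≤ ‖H x - z • x‖ := by
  rcases eq_or_ne x 0 with rfl | hx
  · simp
  have him : (inner ℂ x (H x)).im = 0 := hH.isSymmetric.im_inner_self_apply x
  have key : (inner ℂ x (H x - z • x)).im = -(z.im * ‖x‖ ^ 2) := by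
    rw [inner_sub_right, inner_smul_right, inner_self_eq_norm_sq_to_K, Complex.sub_im, him]
    simp [← Complex.ofReal_pow]
  have hle : |z.im| * ‖x‖ ^ 2 ≤ ‖x‖ * ‖H x - z • x‖ := calc
    |z.im| * ‖x‖ ^ 2 = |(inner ℂ x (H x - z • x)).im| := by
      rw [key, abs_neg, abs_mul, abs_of_nonneg (sq_nonneg ‖x‖)]
    _ ≤ ‖inner ℂ x (H x - z • x)‖ := Complex.abs_im_le_norm _
    _ ≤ ‖x‖ * ‖H x - z • x‖ := norm_inner_le_norm _ _
  have hpos : 0 < ‖x‖ := norm_pos_iff.mpr hx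
  exact le_of_mul_le_mul_left (by linarith [pow_two ‖x‖, mul_left_comm |z.im| ‖x‖ ‖x‖]) hpos

theorem isUnit_sub_smul_one_of_isSelfAdjoint {H : E →L[ℂ] E} (hH : IsSelfAdjoint H) {z : ℂ}
    (hz : z.im ≠ 0) : IsUnit (H - z • 1) := by
  have h : z ∉ spectrum ℂ H := fun h => hz (hH.im_eq_zero_of_mem_spectrum h)
  rw [spectrum.notMem_iff, ← IsUnit.neg_iff, neg_sub, Algebra.algebraMap_eq_smul_one] at h
  exact h

/-- A large weighted resolvent produces an approximate solution of `(H - z) f = 0` with `W f`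
normalized. -/
theorem exists_norm_eq_one_of_lt_norm_weighted_resolvent {H : E →L[ℂ] E} (hH : IsSelfAdjoint H)
    (W : E →L[ℂ] E) {z : ℂ} (hz : z.im ≠ 0) {C : ℝ} (hC : 0 < C)
    (hlt : C < ‖W * Ring.inverse (H - z • 1) * W‖) :
    ∃ f u : E, W u = H f - z • f ∧ ‖W f‖ = 1 ∧ ‖u‖ ≤ C⁻¹ := by
  obtain ⟨v, hv⟩ : ∃ v, C * ‖v‖ < ‖(W * Ring.inverse (H - z • 1) * W) v‖ := by
    by_contra! h
    exact hlt.not_ge (opNorm_le_bound _ hC.le h)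
  set g := Ring.inverse (H - z • 1) (W v) with hg
  have hWg : C * ‖v‖ < ‖W g‖ := hv
  have hpos : 0 < ‖W g‖ := (by positivity : 0 ≤ C * ‖v‖).trans_lt hWg
  have hres : W v = H g - z • g := by
    have h := DFunLike.congr_fun
      (Ring.mul_inverse_cancel _ (isUnit_sub_smul_one_of_isSelfAdjoint hH hz)) (W v)
    simpa [← hg] using h.symm
  refine ⟨((‖W g‖⁻¹ : ℝ) : ℂ) • g, ((‖W g‖⁻¹ : ℝ) : ℂ) • v, ?_, ?_, ?_⟩
  · rw [map_smul, map_smul, hres, smul_sub, smul_comm z]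
  · rw [map_smul, norm_smul, Complex.norm_real, norm_inv, norm_norm, inv_mul_cancel₀ hpos.ne']
  · rw [norm_smul, Complex.norm_real, norm_inv, norm_norm, inv_mul_le_iff₀ hpos,
      ← div_eq_mul_inv, le_div_iff₀ hC]
    linarith

theorem norm_apply_le_of_eq_sub_smul {H : E →L[ℂ] E} (hH : IsSelfAdjoint H) (W : E →L[ℂ] E)
    {z : ℂ} (hz : z.im ≠ 0) {f u : E} (h : W u = H f - z • f) :
    ‖W f‖ ≤ ‖W * Ring.inverse (H - z • 1) * W‖ * ‖u‖ := by
  have hf : (W * Ring.inverse (H - z • 1) * W) u = W f := by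
    have h' := DFunLike.congr_fun
      (Ring.inverse_mul_cancel _ (isUnit_sub_smul_one_of_isSelfAdjoint hH hz)) f
    have hu : W u = (H - z • 1) f := by simp [h]
    change W (Ring.inverse (H - z • 1) (W u)) = W f
    rw [hu]
    exact congrArg W h'
  exact hf ▸ le_opNorm _ u

theorem abs_im_mul_norm_apply_le {H : E →L[ℂ] E} (hH : IsSelfAdjoint H) (W : E →L[ℂ] E)
    {z : ℂ} {f u : E} (h : W u = H f - z • f) : |z.im| * ‖W f‖ ≤ ‖W‖ * (‖W‖ * ‖u‖) := calc
  |z.im| * ‖W f‖ ≤ |z.im| * (‖W‖ * ‖f‖) := by gcongr; exact W.le_opNorm f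
  _ = ‖W‖ * (|z.im| * ‖f‖) := by ring
  _ ≤ ‖W‖ * ‖W u‖ := by
    rw [h]; gcongr; exact abs_im_mul_norm_le_of_isSelfAdjoint hH z f
  _ ≤ ‖W‖ * (‖W‖ * ‖u‖) := by gcongr; exact W.le_opNorm u

end ContinuousLinearMap

/-- The limiting absorption principle for `H` relative to
`(I, W)` fails, i.e. `sup {‖W (H − z)⁻¹ W‖ : Re z ∈ I, Im z ≠ 0} = ∞`, if and
only if there is a special sequence for `H` relative to `(I, W)` with strictly
positive mass. -/
theorem lap_fails_iff_special_sequence_with_positive_mass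
    {E : Type*} [NormedAddCommGroup E] [InnerProductSpace ℂ E] [CompleteSpace E]
    (H W : E →L[ℂ] E) (hH : IsSelfAdjoint H) (hW : IsSelfAdjoint W)
    (hWinj : Function.Injective W)
    (a b : ℝ) (I : Set ℝ) (hI : I = Set.Icc a b) :
    (¬ ∃ C : ℝ, ∀ z : ℂ, z.re ∈ I → z.im ≠ 0 →
        ‖W * Ring.inverse (H - z • 1) * W‖ ≤ C) ↔
      ∃ (f : ℕ → E) (zs : ℕ → ℂ) (η : ℝ), 0 < η ∧
        IsSpecialSequence H W I f zs η := by
  constructor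
  · intro hlap
    push Not at hlap
    have hex (n : ℕ) : ∃ (z : ℂ) (f u : E), z.re ∈ I ∧ z.im ≠ 0 ∧ W u = H f - z • f ∧
        ‖W f‖ = 1 ∧ ‖u‖ ≤ ((n : ℝ) + 1)⁻¹ := by
      obtain ⟨z, hre, him, hlt⟩ := hlap (n + 1)
      obtain ⟨f, u, h⟩ := ContinuousLinearMap.exists_norm_eq_one_of_lt_norm_weighted_resolvent
        hH W him (by positivity) hlt
      exact ⟨z, f, u, hre, him, h⟩
    choose z f u hre him heq hnorm hu using hex
    have hu0 : Tendsto (fun n => ‖u n‖) atTop (nhds 0) :=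
      squeeze_zero (fun _ => norm_nonneg _) hu
        (by simpa only [one_div] using tendsto_one_div_add_atTop_nhds_zero_nat (𝕜 := ℝ))
    have him0 : Tendsto (fun n => (z n).im) atTop (nhds 0) := by
      refine squeeze_zero_norm (a := fun n => ‖W‖ * (‖W‖ * ‖u n‖)) (fun n => ?_) ?_
      · simpa [hnorm] using ContinuousLinearMap.abs_im_mul_norm_apply_le hH W (heq n)
      · simpa using (hu0.const_mul ‖W‖).const_mul ‖W‖
    have hcompact : IsCompact I := hI ▸ isCompact_Icc
    obtain ⟨lam, hlam, φ, hφ, hlim⟩ := hcompact.tendsto_subseq hre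
    refine ⟨f ∘ φ, z ∘ φ, 1, one_pos, zero_le_one, lam, hlam, fun n => hre _, hlim,
      fun n => him _, him0.comp hφ.tendsto_atTop, ?_, u ∘ φ, fun n => heq _,
      hu0.comp hφ.tendsto_atTop⟩
    simp [hnorm]
  · rintro ⟨f, z, η, hη, -, lam, -, hre, -, him, -, hWf, u, heq, hu⟩ ⟨C, hC⟩
    have hle : ∀ n, ‖W (f n)‖ ≤ C * ‖u n‖ := fun n =>
      (ContinuousLinearMap.norm_apply_le_of_eq_sub_smul hH W (him n) (heq n)).trans
        (mul_le_mul_of_nonneg_right (hC _ (hre n) (him n)) (norm_nonneg _))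
    have hη0 : η ≤ C * 0 := le_of_tendsto_of_tendsto' hWf (hu.const_mul C) hle
    linarith
end

section
/- Let ℋ be a complex Hilbert space, H a bounded self-adjoint operator on ℋ, W a bounded, self-adjoint, injective operator on ℋ, and I ⊆ ℝ a compact interval. Let (f_n, z_n) be a special sequence for H relative to (I, W). Let θ : ℝ → ℝ be a bounded continuous function equal to 1 on some open set containing I. Then (1 − θ)(H) f_n → 0 in ℋ, where (1 − θ)(H) is given by the continuous functional calculus of the bounded self-adjoint operator H. -/
open Filter

/-- A continuous function of a self-adjoint operator which vanishes on a ball around `lam` has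
a range on which `H - lam` is bounded below, with an explicit left inverse. -/
theorem exists_mul_sub_algebraMap_mul_cfc_eq {A : Type*} [CStarAlgebra A]
    {H : A} (hH : IsSelfAdjoint H) {φ : ℝ → ℝ} (hφ : Continuous φ)
    {lam δ : ℝ} (hδ : 0 < δ) (hzero : ∀ t, |t - lam| < δ → φ t = 0) :
    ∃ Q : A, Q * (H - algebraMap ℝ A lam) * cfc φ H = cfc φ H := by
  have hpos : ∀ t : ℝ, 0 < max ((t - lam) ^ 2) (δ ^ 2) := fun t => lt_max_of_lt_right (by positivity)
  have hq : Continuous fun t : ℝ => (t - lam) / max ((t - lam) ^ 2) (δ ^ 2) :=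
    Continuous.div (by fun_prop) (by fun_prop) fun t => (hpos t).ne'
  refine ⟨cfc (fun t : ℝ => (t - lam) / max ((t - lam) ^ 2) (δ ^ 2)) H, ?_⟩
  have hsub : H - algebraMap ℝ A lam = cfc (fun t : ℝ => t - lam) H := by
    rw [cfc_sub (fun t : ℝ => t) (fun _ => lam) H, cfc_id' ℝ H, cfc_const lam H]
  rw [hsub, ← cfc_mul _ _ H hq.continuousOn (by fun_prop),
    ← cfc_mul (fun t => (t - lam) / max ((t - lam) ^ 2) (δ ^ 2) * (t - lam)) φ H
      (hq.mul (by fun_prop)).continuousOn hφ.continuousOn]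
  refine cfc_congr fun t _ => ?_
  by_cases ht : |t - lam| < δ
  · simp [hzero t ht]
  · have hle : δ ^ 2 ≤ (t - lam) ^ 2 := by
      rw [← sq_abs (t - lam)]
      exact pow_le_pow_left₀ hδ.le (not_lt.mp ht) 2
    have hne : t - lam ≠ 0 := fun h => ht (by simpa [h] using hδ)
    simp only [max_eq_left hle]
    field_simp

/-- If `(H - z n) (h n) → 0` with `z n → lam` and `H - lam` has a bounded left inverse on all
the vectors `h n`, then `h n → 0`. -/
theorem tendsto_zero_of_tendsto_sub_smul {E : Type*} [NormedAddCommGroup E] [NormedSpace ℂ E]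
    {H Q : E →L[ℂ] E} {h : ℕ → E} {z : ℕ → ℂ} {lam : ℂ}
    (hQ : ∀ n, Q (H (h n) - lam • h n) = h n) (hz : Tendsto z atTop (nhds lam))
    (hh : Tendsto (fun n => H (h n) - z n • h n) atTop (nhds 0)) :
    Tendsto h atTop (nhds 0) := by
  have hsmall : ∀ᶠ n in atTop, ‖Q‖ * ‖z n - lam‖ < 1 / 2 := by
    have hlim : Tendsto (fun n => ‖Q‖ * ‖z n - lam‖) atTop (nhds 0) := by
      simpa using (tendsto_iff_norm_sub_tendsto_zero.mp hz).const_mul ‖Q‖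
    exact hlim.eventually_lt_const (by norm_num)
  refine squeeze_zero_norm' (a := fun n => 2 * ‖Q‖ * ‖H (h n) - z n • h n‖) ?_
    (by simpa using hh.norm.const_mul (2 * ‖Q‖))
  filter_upwards [hsmall] with n hn
  have hbound : ‖h n‖ ≤ ‖Q‖ * (‖H (h n) - z n • h n‖ + ‖z n - lam‖ * ‖h n‖) := by
    calc ‖h n‖ = ‖Q ((H (h n) - z n • h n) + (z n - lam) • h n)‖ := by
          rw [sub_smul, sub_add_sub_cancel, hQ n]
      _ ≤ ‖Q‖ * ‖(H (h n) - z n • h n) + (z n - lam) • h n‖ := Q.le_opNorm _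
      _ ≤ _ := by
          gcongr
          exact (norm_add_le _ _).trans_eq (by rw [norm_smul])
  have := mul_le_mul_of_nonneg_right hn.le (norm_nonneg (h n))
  linarith

/-- Let `(f n, z n)` be a special sequence for the bounded
self-adjoint operator `H` relative to `(I, W)`, and let `θ : ℝ → ℝ` be a bounded
continuous function equal to `1` on an open set containing `I`.  Then
`(1 − θ)(H) (f n) → 0`, where `(1 − θ)(H)` is given by the continuous functional
calculus of `H`. -/
theorem special_sequence_localizes_in_energy
    {E : Type*} [NormedAddCommGroup E] [InnerProductSpace ℂ E] [CompleteSpace E]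
    (H W : E →L[ℂ] E) (hH : IsSelfAdjoint H) (hW : IsSelfAdjoint W)
    (hWinj : Function.Injective W)
    (a b : ℝ) (I : Set ℝ) (hI : I = Set.Icc a b)
    (f : ℕ → E) (z : ℕ → ℂ) (η : ℝ)
    (hspec : IsSpecialSequence H W I f z η)
    (θ : ℝ → ℝ) (hθcont : Continuous θ) (hθbdd : ∃ M : ℝ, ∀ t, |θ t| ≤ M)
    (hθone : ∃ U : Set ℝ, IsOpen U ∧ I ⊆ U ∧ ∀ t ∈ U, θ t = 1) :
    Tendsto (fun n => (cfc (fun t : ℝ => 1 - θ t) H) (f n)) atTop (nhds 0) := by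
  obtain ⟨-, lam, hlam, -, hre, -, him, -, u, hu, hu0⟩ := hspec
  obtain ⟨U, hUo, hIU, hU⟩ := hθone
  obtain ⟨δ, hδ, hball⟩ := Metric.isOpen_iff.mp hUo lam (hIU hlam)
  have hz : Tendsto z atTop (nhds (lam : ℂ)) := by
    have hofReal := (Complex.continuous_ofReal.tendsto lam).comp hre
    have hofIm := (Complex.continuous_ofReal.tendsto 0).comp him
    simpa [Function.comp_def, Complex.re_add_im] using hofReal.add (hofIm.mul_const Complex.I)
  obtain ⟨Q, hQ⟩ := exists_mul_sub_algebraMap_mul_cfc_eq hH (φ := fun t => 1 - θ t)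
    (by fun_prop) hδ fun t ht => by
      rw [hU t (hball (by rwa [Metric.mem_ball, Real.dist_eq])), sub_self]
  set P := cfc (fun t : ℝ => 1 - θ t) H
  have hcomm : ∀ x, H (P x) = P (H x) := fun x => by
    have h := cfc_commute_cfc (fun t : ℝ => t) (fun t : ℝ => 1 - θ t) H
    rw [cfc_id' ℝ H] at h
    exact DFunLike.congr_fun h.eq x
  refine tendsto_zero_of_tendsto_sub_smul (H := H) (Q := Q) (z := z) (lam := lam) ?_ hz ?_
  · intro n
    simpa [Algebra.algebraMap_eq_smul_one] using DFunLike.congr_fun hQ (f n)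
  · have hPW : ∀ n, H (P (f n)) - z n • P (f n) = P (W (u n)) := fun n => by
      rw [hu, map_sub, map_smul, hcomm]
    simp only [hPW]
    simpa [Function.comp_def] using ((P.comp W).continuous.tendsto 0).comp (tendsto_zero_iff_norm_tendsto_zero.mpr hu0)
end

section
/- Let s ∈ (1/2, 1), σ ∈ {−1, +1}, and let h be a real number with h > sup_{t∈ℝ} |t|⟨t⟩^{−2s}. Then the function w(x) := (h − σ x ⟨x⟩^{−2s})^{1/2} is smooth and belongs to S⁰. Moreover, if a, b : ℝ → ℝ are smooth functions such that a is compactly supported in ℝ \ {0}, b is bounded, and b' is compactly supported in ℝ \ {0}, then the family of functions ψ_R(x) := a(x/R) · (h − σ x ⟨x⟩^{−2s})^{1/2} · b(x/R), for R ≥ 1, is bounded in S⁰. -/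
open scoped ContDiff

/-- The family `f` satisfies the symbol estimates of order `ρ`, uniformly in the index,
for the derivatives of order at most `n`. -/
def SymbolBoundUpTo {ι : Type*} (n : ℕ) (ρ : ℝ) (f : ι → ℝ → ℝ) : Prop :=
  ∀ k ≤ n, ∃ C : ℝ, ∀ i t,
    |iteratedDeriv k (f i) t| ≤ C * (1 + t ^ 2) ^ ((ρ - k) / 2)

namespace SymbolBoundUpTo

variable {ι : Type*} {n : ℕ} {ρ ρ' : ℝ} {f g : ι → ℝ → ℝ}

theorem of_le (hf : SymbolBoundUpTo n ρ f) {m : ℕ} (hm : m ≤ n) : SymbolBoundUpTo m ρ f :=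
  fun k hk => hf k (hk.trans hm)

theorem mono (hf : SymbolBoundUpTo n ρ f) (hρ : ρ ≤ ρ') : SymbolBoundUpTo n ρ' f := by
  intro k hk
  obtain ⟨C, hC⟩ := hf k hk
  refine ⟨|C|, fun i t => (hC i t).trans ?_⟩
  have h1 : (1 : ℝ) ≤ 1 + t ^ 2 := by nlinarith [sq_nonneg t]
  gcongr
  exact le_abs_self C

theorem const (n : ℕ) (c : ℝ) : SymbolBoundUpTo n 0 (fun (_ : ι) (_ : ℝ) => c) := by
  intro k _
  refine ⟨|c|, fun i t => ?_⟩
  rw [iteratedDeriv_const]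
  split_ifs with h
  · simp [h]
  · rw [abs_zero]
    positivity

theorem add (hf : SymbolBoundUpTo n ρ f) (hg : SymbolBoundUpTo n ρ g)
    (hfs : ∀ i, ContDiff ℝ ∞ (f i)) (hgs : ∀ i, ContDiff ℝ ∞ (g i)) :
    SymbolBoundUpTo n ρ (fun i t => f i t + g i t) := by
  intro k hk
  obtain ⟨C, hC⟩ := hf k hk
  obtain ⟨D, hD⟩ := hg k hk
  refine ⟨C + D, fun i t => ?_⟩
  rw [iteratedDeriv_fun_add ((hfs i).of_le (mod_cast le_top)).contDiffAt
    ((hgs i).of_le (mod_cast le_top)).contDiffAt, add_mul]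
  exact (abs_add_le _ _).trans (add_le_add (hC i t) (hD i t))

theorem mul (hf : SymbolBoundUpTo n ρ f) (hg : SymbolBoundUpTo n ρ' g)
    (hfs : ∀ i, ContDiff ℝ ∞ (f i)) (hgs : ∀ i, ContDiff ℝ ∞ (g i)) :
    SymbolBoundUpTo n (ρ + ρ') (fun i t => f i t * g i t) := by
  intro k hk
  choose! C hC using hf
  choose! D hD using hg
  refine ⟨∑ j ∈ Finset.range (k + 1), k.choose j * C j * D (k - j), fun i t => ?_⟩
  rw [iteratedDeriv_fun_mul ((hfs i).of_le (mod_cast le_top)).contDiffAt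
    ((hgs i).of_le (mod_cast le_top)).contDiffAt, Finset.sum_mul]
  refine (Finset.abs_sum_le_sum_abs _ _).trans (Finset.sum_le_sum fun j hj => ?_)
  have hjk : j ≤ k := Nat.lt_succ_iff.mp (Finset.mem_range.mp hj)
  have hF := hC j (hjk.trans hk) i t
  have hG := hD (k - j) ((Nat.sub_le k j).trans hk) i t
  have hexp : (1 + t ^ 2 : ℝ) ^ ((ρ + ρ' - k) / 2) =
      (1 + t ^ 2) ^ ((ρ - j) / 2) * (1 + t ^ 2) ^ ((ρ' - (k - j : ℕ)) / 2) := by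
    rw [← Real.rpow_add (by positivity), Nat.cast_sub hjk]
    congr 1
    ring
  rw [abs_mul, abs_mul, Nat.abs_cast, hexp]
  calc _ = k.choose j * (|iteratedDeriv j (f i) t| * |iteratedDeriv (k - j) (g i) t|) := by ring
    _ ≤ k.choose j * ((C j * (1 + t ^ 2) ^ ((ρ - j) / 2)) *
        (D (k - j) * (1 + t ^ 2) ^ ((ρ' - (k - j : ℕ)) / 2))) := by
      refine mul_le_mul_of_nonneg_left ?_ (Nat.cast_nonneg _)
      exact mul_le_mul hF hG (abs_nonneg _) ((abs_nonneg _).trans hF)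
    _ = _ := by ring

theorem const_mul (hf : SymbolBoundUpTo n ρ f) (hfs : ∀ i, ContDiff ℝ ∞ (f i)) (c : ℝ) :
    SymbolBoundUpTo n ρ (fun i t => c * f i t) := by
  simpa using (const n c).mul hf (fun _ => contDiff_const) hfs

theorem deriv (hf : SymbolBoundUpTo (n + 1) ρ f) :
    SymbolBoundUpTo n (ρ - 1) (fun i => deriv (f i)) := by
  intro k hk
  obtain ⟨C, hC⟩ := hf (k + 1) (by lia)
  refine ⟨C, fun i t => ?_⟩
  have := hC i t
  rw [iteratedDeriv_succ'] at this
  convert this using 4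
  push_cast
  ring

theorem of_deriv (h0 : SymbolBoundUpTo 0 ρ f)
    (hf : SymbolBoundUpTo n (ρ - 1) (fun i => _root_.deriv (f i))) :
    SymbolBoundUpTo (n + 1) ρ f := by
  rintro (_ | k) hk
  · exact h0 0 le_rfl
  · obtain ⟨C, hC⟩ := hf k (by lia)
    refine ⟨C, fun i t => ?_⟩
    rw [iteratedDeriv_succ']
    convert hC i t using 4
    push_cast
    ring

theorem id (n : ℕ) : SymbolBoundUpTo n 1 (fun (_ : ι) (t : ℝ) => t) := by
  refine (of_deriv ?_ ?_ : SymbolBoundUpTo (n + 1) 1 _).of_le n.le_succ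
  · intro k hk
    obtain rfl : k = 0 := by lia
    refine ⟨1, fun _ t => ?_⟩
    rw [iteratedDeriv_zero, one_mul, Nat.cast_zero, sub_zero, ← Real.sqrt_eq_rpow]
    exact Real.abs_le_sqrt (by linarith)
  · simpa using const (ι := ι) n 1

theorem one_add_sq (n : ℕ) : SymbolBoundUpTo n 2 (fun (_ : ι) (t : ℝ) => 1 + t ^ 2) := by
  have hid : SymbolBoundUpTo n 2 (fun (_ : ι) (t : ℝ) => t * t) := by
    have := (id (ι := ι) n).mul (id n) (fun _ => contDiff_id) (fun _ => contDiff_id)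
    norm_num at this
    exact this
  simp only [sq]
  exact ((const n 1).mono zero_le_two).add hid (fun _ => contDiff_const)
    (fun _ => contDiff_id.mul contDiff_id)

theorem rpow_zero_order (hf : SymbolBoundUpTo 0 ρ f) {c : ℝ} (hc : 0 < c)
    (hlb : ∀ i t, c * (1 + t ^ 2) ^ (ρ / 2) ≤ f i t) (p : ℝ) :
    SymbolBoundUpTo 0 (ρ * p) (fun i t => f i t ^ p) := by
  intro k hk
  obtain rfl : k = 0 := by lia
  obtain ⟨C, hC⟩ := hf 0 le_rfl
  simp only [iteratedDeriv_zero, Nat.cast_zero, sub_zero] at hC ⊢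
  have key (D : ℝ) (hD : 0 ≤ D) (t : ℝ) :
      (D * (1 + t ^ 2) ^ (ρ / 2)) ^ p = D ^ p * (1 + t ^ 2) ^ (ρ * p / 2) := by
    rw [Real.mul_rpow hD (by positivity), ← Real.rpow_mul (by positivity)]
    ring_nf
  have hpos (i t) : 0 < f i t := lt_of_lt_of_le (by positivity) (hlb i t)
  rcases le_total 0 p with hp | hp
  · refine ⟨|C| ^ p, fun i t => ?_⟩
    rw [abs_of_pos (Real.rpow_pos_of_pos (hpos i t) p), ← key _ (abs_nonneg C)]
    refine Real.rpow_le_rpow (hpos i t).le ((le_abs_self _).trans ((hC i t).trans ?_)) hp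
    gcongr
    exact le_abs_self C
  · refine ⟨c ^ p, fun i t => ?_⟩
    rw [abs_of_pos (Real.rpow_pos_of_pos (hpos i t) p), ← key _ hc.le]
    exact Real.rpow_le_rpow_of_nonpos (by positivity) (hlb i t) hp

/-- Real powers of an elliptic family of positive symbols. -/
theorem rpow (hf : SymbolBoundUpTo n ρ f) (hfs : ∀ i, ContDiff ℝ ∞ (f i)) {c : ℝ} (hc : 0 < c)
    (hlb : ∀ i t, c * (1 + t ^ 2) ^ (ρ / 2) ≤ f i t) (p : ℝ) :
    SymbolBoundUpTo n (ρ * p) (fun i t => f i t ^ p) := by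
  have hne (i t) : f i t ≠ 0 := (lt_of_lt_of_le (by positivity) (hlb i t)).ne'
  induction n generalizing p with
  | zero => exact rpow_zero_order hf hc hlb p
  | succ n ih =>
    refine of_deriv (rpow_zero_order (hf.of_le n.succ.zero_le) hc hlb p) ?_
    have hd (i) : _root_.deriv (fun t => f i t ^ p) =
        fun t => (p * f i t ^ (p - 1)) * _root_.deriv (f i) t := by
      ext t
      rw [deriv_rpow_const ((hfs i).differentiable (by simp)).differentiableAt (.inl (hne i t))]
      ring
    have hps (i) : ContDiff ℝ ∞ (fun t => f i t ^ (p - 1)) :=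
      (hfs i).rpow_const_of_ne (hne i)
    simp only [hd]
    convert ((ih (hf.of_le n.le_succ) (p - 1)).const_mul hps p).mul hf.deriv
      (fun i => contDiff_const.mul (hps i)) (fun i => (contDiff_infty_iff_deriv.mp (hfs i)).2)
      using 1
    ring

end SymbolBoundUpTo

theorem HasCompactSupport.iteratedDeriv_succ {f : ℝ → ℝ} (hf : HasCompactSupport (deriv f))
    (k : ℕ) : HasCompactSupport (iteratedDeriv (k + 1) f) := by
  induction k with
  | zero => rwa [zero_add, iteratedDeriv_one]
  | succ k ih =>
    rw [_root_.iteratedDeriv_succ]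
    exact ih.deriv

/-- Dilations by `R ≥ 1` of a bounded smooth function whose derivative is compactly supported
are uniformly symbols of order zero. -/
theorem SymbolBoundUpTo.dilation {f : ℝ → ℝ} (hfs : ContDiff ℝ ∞ f)
    (hbdd : ∃ M : ℝ, ∀ x, |f x| ≤ M) (hsupp : HasCompactSupport (_root_.deriv f)) (n : ℕ) :
    SymbolBoundUpTo n 0 (fun (R : Set.Ici (1 : ℝ)) x => f (x / R)) := by
  rintro (_ | k) -
  · obtain ⟨M, hM⟩ := hbdd
    exact ⟨M, fun R t => by simpa using hM (t / R)⟩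
  have hcs := hsupp.iteratedDeriv_succ k
  obtain ⟨M, hM⟩ := hcs.exists_bound_of_continuous
    (hfs.continuous_iteratedDeriv (k + 1) (mod_cast le_top))
  obtain ⟨K, hK⟩ := hcs.isCompact.isBounded.exists_norm_le
  have hM0 : 0 ≤ M := (norm_nonneg _).trans (hM 0)
  refine ⟨M * (1 + K ^ 2) ^ (((k + 1 : ℕ) : ℝ) / 2), fun ⟨R, hR⟩ t => ?_⟩
  have hR1 : (1 : ℝ) ≤ R := hR
  have hR0 : (0 : ℝ) < R := by linarith
  have hcomp : iteratedDeriv (k + 1) (fun x => f (x / R)) t =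
      R⁻¹ ^ (k + 1) * iteratedDeriv (k + 1) f (R⁻¹ * t) := by
    rw [← congrFun (iteratedDeriv_comp_const_mul (hfs.of_le (mod_cast le_top)) R⁻¹) t]
    simp only [div_eq_inv_mul]
  rw [hcomp]
  by_cases ht : R⁻¹ * t ∈ tsupport (iteratedDeriv (k + 1) f)
  · have htK := hK _ ht
    rw [Real.norm_eq_abs, abs_mul, abs_inv, abs_of_pos hR0, inv_mul_le_iff₀ hR0] at htK
    have hle : 1 + t ^ 2 ≤ (1 + K ^ 2) * R ^ 2 := by
      have := pow_le_pow_left₀ (abs_nonneg t) htK 2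
      rw [sq_abs] at this
      nlinarith [sq_nonneg K]
    have hw : (1 + t ^ 2 : ℝ) ^ (((k + 1 : ℕ) : ℝ) / 2) ≤
        (1 + K ^ 2) ^ (((k + 1 : ℕ) : ℝ) / 2) * R ^ (k + 1) := by
      refine (Real.rpow_le_rpow (by positivity) hle (by positivity)).trans_eq ?_
      rw [Real.mul_rpow (by positivity) (by positivity), ← Real.rpow_natCast R 2,
        ← Real.rpow_mul hR0.le, ← Real.rpow_natCast R (k + 1)]
      congr 2
      push_cast
      ring
    have hpos : (0 : ℝ) < (1 + t ^ 2) ^ (((k + 1 : ℕ) : ℝ) / 2) := by positivity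
    have hRk : (0 : ℝ) < R ^ (k + 1) := by positivity
    have hinv : (1 + t ^ 2 : ℝ) ^ ((0 - ((k + 1 : ℕ) : ℝ)) / 2) =
        ((1 + t ^ 2) ^ (((k + 1 : ℕ) : ℝ) / 2))⁻¹ := by
      rw [← Real.rpow_neg (by positivity)]
      congr 1
      ring
    rw [hinv, ← div_eq_mul_inv, abs_mul, abs_of_pos (a := R⁻¹ ^ (k + 1)) (by positivity),
      inv_pow, le_div_iff₀ hpos, mul_assoc, inv_mul_le_iff₀ hRk]
    calc _ ≤ M * ((1 + K ^ 2) ^ (((k + 1 : ℕ) : ℝ) / 2) * R ^ (k + 1)) :=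
          mul_le_mul (hM _) hw hpos.le hM0
      _ = _ := by ring
  · rw [image_eq_zero_of_notMem_tsupport ht, mul_zero, abs_zero]
    positivity

theorem contDiff_one_add_sq_rpow (p : ℝ) : ContDiff ℝ ∞ (fun x : ℝ => (1 + x ^ 2) ^ p) :=
  ContDiff.rpow_const_of_ne (by fun_prop) fun x => by positivity

theorem symbolBoundUpTo_weight_sq {ι : Type*} {s : ℝ} (hs : 1 / 2 < s) (σ h : ℝ) (n : ℕ) :
    SymbolBoundUpTo n 0 (fun (_ : ι) (x : ℝ) => h - σ * x * (1 + x ^ 2) ^ (-s)) := by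
  have hpow : SymbolBoundUpTo n (2 * -s) (fun (_ : ι) (x : ℝ) => (1 + x ^ 2) ^ (-s)) :=
    (SymbolBoundUpTo.one_add_sq n).rpow (fun _ => by fun_prop) one_pos (by simp) (-s)
  have hx : SymbolBoundUpTo n 0 (fun (_ : ι) (x : ℝ) => x * (1 + x ^ 2) ^ (-s)) :=
    ((SymbolBoundUpTo.id n).mul hpow (fun _ => contDiff_id)
      (fun _ => contDiff_one_add_sq_rpow _)).mono (by linarith)
  have hxs : ContDiff ℝ ∞ (fun x : ℝ => x * (1 + x ^ 2) ^ (-s)) :=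
    contDiff_id.mul (contDiff_one_add_sq_rpow _)
  convert (SymbolBoundUpTo.const n h).add (hx.const_mul (fun _ => hxs) (-σ))
    (fun _ => contDiff_const) (fun _ => contDiff_const.mul hxs) using 3
  ring

theorem SymbolBoundUpTo.weighted_bound {ι : Type*} {k : ℕ} {f : ι → ℝ → ℝ}
    (hf : SymbolBoundUpTo k 0 f) :
    ∃ C : ℝ, ∀ i t, (1 + t ^ 2) ^ ((k : ℝ) / 2) * |iteratedDeriv k (f i) t| ≤ C := by
  obtain ⟨C, hC⟩ := hf k le_rfl
  refine ⟨C, fun i t => ?_⟩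
  refine (mul_le_mul_of_nonneg_left (hC i t) (by positivity)).trans_eq ?_
  rw [mul_left_comm, ← Real.rpow_add (by positivity), ← add_div]
  simp


/-- Let `s ∈ (1/2, 1)`, `σ ∈ {−1, +1}`, and `h` a real number
with `h > sup_t |t| ⟨t⟩^{−2s}` (where `⟨t⟩^{−2s} = (1 + t²)^{−s}`).  Then
`w(x) := (h − σ x ⟨x⟩^{−2s})^{1/2}` is smooth and belongs to `S⁰`.  Moreover, if
`a, b : ℝ → ℝ` are smooth, `a` is compactly supported in `ℝ \ {0}`, `b` is
bounded and `b'` is compactly supported in `ℝ \ {0}`, then the family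
`ψ_R(x) := a(x/R) w(x) b(x/R)`, `R ≥ 1`, is bounded in `S⁰`. -/
theorem weight_symbol_bounded_in_S0
    (s : ℝ) (hs : 1 / 2 < s) (hs1 : s < 1)
    (σ : ℝ) (hσ : σ = 1 ∨ σ = -1)
    (h : ℝ) (hh : ∃ M : ℝ, (∀ t : ℝ, |t| * (1 + t ^ 2) ^ (-s) ≤ M) ∧ M < h)
    (a b : ℝ → ℝ)
    (ha : ContDiff ℝ (⊤ : ℕ∞) a) (hasupp : HasCompactSupport a)
    (ha0 : tsupport a ⊆ {x : ℝ | x ≠ 0})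
    (hb : ContDiff ℝ (⊤ : ℕ∞) b) (hbbdd : ∃ M : ℝ, ∀ x, |b x| ≤ M)
    (hbsupp : HasCompactSupport (deriv b))
    (hb0 : tsupport (deriv b) ⊆ {x : ℝ | x ≠ 0}) :
    (ContDiff ℝ (⊤ : ℕ∞)
        (fun x : ℝ => Real.sqrt (h - σ * x * (1 + x ^ 2) ^ (-s))) ∧
      ∀ k : ℕ, ∃ C : ℝ, ∀ t : ℝ,
        (1 + t ^ 2) ^ ((k : ℝ) / 2) *
          |iteratedDeriv k
            (fun x : ℝ => Real.sqrt (h - σ * x * (1 + x ^ 2) ^ (-s))) t| ≤ C) ∧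
    ∀ k : ℕ, ∃ C : ℝ, ∀ R : ℝ, 1 ≤ R → ∀ t : ℝ,
      (1 + t ^ 2) ^ ((k : ℝ) / 2) *
        |iteratedDeriv k
          (fun x : ℝ =>
            a (x / R) * Real.sqrt (h - σ * x * (1 + x ^ 2) ^ (-s)) * b (x / R)) t|
        ≤ C := by
  obtain ⟨M, hM, hMh⟩ := hh
  set g : ℝ → ℝ := fun x => h - σ * x * (1 + x ^ 2) ^ (-s) with hg
  have hgM (t : ℝ) : h - M ≤ g t := by
    have h1 : |σ * t * (1 + t ^ 2) ^ (-s)| ≤ M := by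
      have hσ' : |σ| = 1 := by rcases hσ with rfl | rfl <;> simp
      rw [abs_mul, abs_mul, hσ', one_mul, abs_of_pos (a := (1 + t ^ 2) ^ (-s)) (by positivity)]
      exact hM t
    have := (abs_le.mp h1).2
    simp only [hg]
    linarith
  have hgs : ContDiff ℝ ∞ g :=
    contDiff_const.sub ((contDiff_const.mul contDiff_id).mul (contDiff_one_add_sq_rpow _))
  have hws : ContDiff ℝ ∞ (fun x => √(g x)) :=
    hgs.sqrt fun x => (lt_of_lt_of_le (sub_pos.mpr hMh) (hgM x)).ne'
  have hw (n : ℕ) : SymbolBoundUpTo n 0 (fun (_ : Set.Ici (1 : ℝ)) x => √(g x)) := by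
    have := (symbolBoundUpTo_weight_sq (ι := Set.Ici (1 : ℝ)) hs σ h n).rpow (fun _ => hgs)
      (sub_pos.mpr hMh) (fun _ t => by simpa using hgM t) (1 / 2)
    simpa only [Real.sqrt_eq_rpow, zero_mul] using this
  refine ⟨⟨hws, fun k => ?_⟩, fun k => ?_⟩
  · obtain ⟨C, hC⟩ := (hw k).weighted_bound
    exact ⟨C, hC ⟨1, Set.self_mem_Ici⟩⟩
  · have hA := SymbolBoundUpTo.dilation ha (hasupp.exists_bound_of_continuous ha.continuous)
      hasupp.deriv k
    have hB := SymbolBoundUpTo.dilation hb hbbdd hbsupp k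
    have has (R : Set.Ici (1 : ℝ)) : ContDiff ℝ ∞ (fun x => a (x / R)) :=
      ha.comp (contDiff_id.div_const _)
    have hbs (R : Set.Ici (1 : ℝ)) : ContDiff ℝ ∞ (fun x => b (x / R)) :=
      hb.comp (contDiff_id.div_const _)
    have hAB := (hA.mul (hw k) has fun _ => hws).mul hB (fun R => (has R).mul hws) hbs
    simp only [add_zero] at hAB
    obtain ⟨C, hC⟩ := hAB.weighted_bound
    exact ⟨C, fun R hR t => hC ⟨R, hR⟩ t⟩
end

section
/- Let ℋ be a complex Hilbert space and H a bounded self-adjoint operator on ℋ. Let θ, τ : ℝ → ℝ be bounded continuous functions with τ(t)·θ(t) = θ(t) for all t ∈ ℝ. Set H_τ := H·τ(H), i.e. the continuous functional calculus of H applied to t ↦ t·τ(t). Then for every z ∈ ℂ with Im z ≠ 0, both H − z and H_τ − z are boundedly invertible and (H − z)^{-1} θ(H) = (H_τ − z)^{-1} θ(H). -/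
/-- Two units that agree after right multiplication by `c`, one of them commuting with `c`, have
inverses that agree after right multiplication by `c`. -/
theorem Ring.inverse_mul_eq_inverse_mul_of_mul_eq {R : Type*} [Ring R] {a b c : R}
    (ha : IsUnit a) (hb : IsUnit b) (h : a * c = b * c) (hbc : Commute b c) :
    Ring.inverse a * c = Ring.inverse b * c := by
  obtain ⟨u, rfl⟩ := ha
  obtain ⟨v, rfl⟩ := hb
  rw [Ring.inverse_unit, Ring.inverse_unit, Units.inv_mul_eq_iff_eq_mul,
    hbc.units_inv_left.eq, ← mul_assoc, h, hbc.eq, Units.mul_inv_cancel_right]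

theorem IsSelfAdjoint.isUnit_sub_smul_one {A : Type*} [CStarAlgebra A] {a : A}
    (ha : IsSelfAdjoint a) {z : ℂ} (hz : z.im ≠ 0) : IsUnit (a - z • 1) := by
  have hmem : z ∉ spectrum ℂ a := fun h => hz (ha.im_eq_zero_of_mem_spectrum h)
  rw [spectrum.notMem_iff, Algebra.algebraMap_eq_smul_one] at hmem
  simpa using hmem.neg


/-- Let `H` be a bounded self-adjoint operator on a complex
Hilbert space and `θ, τ : ℝ → ℝ` bounded continuous functions with `τ θ = θ`.
Set `H_τ := H τ(H) = cfc (fun t => t * τ t) H`.  Then for every `z` with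
`Im z ≠ 0`, both `H − z` and `H_τ − z` are invertible and
`(H − z)⁻¹ θ(H) = (H_τ − z)⁻¹ θ(H)`. -/
theorem resolvent_localized_hamiltonian
    {E : Type*} [NormedAddCommGroup E] [InnerProductSpace ℂ E] [CompleteSpace E]
    (H : E →L[ℂ] E) (hH : IsSelfAdjoint H)
    (θ τ : ℝ → ℝ) (hθcont : Continuous θ) (hτcont : Continuous τ)
    (hθbdd : ∃ M : ℝ, ∀ t, |θ t| ≤ M) (hτbdd : ∃ M : ℝ, ∀ t, |τ t| ≤ M)
    (hτθ : ∀ t, τ t * θ t = θ t) :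
    ∀ z : ℂ, z.im ≠ 0 →
      IsUnit (H - z • 1) ∧ IsUnit (cfc (fun t : ℝ => t * τ t) H - z • 1) ∧
      Ring.inverse (H - z • 1) * cfc θ H
        = Ring.inverse (cfc (fun t : ℝ => t * τ t) H - z • 1) * cfc θ H := by
  intro z hz
  have hA := hH.isUnit_sub_smul_one hz
  have hB := (cfc_predicate (R := ℝ) (fun t => t * τ t) H).isUnit_sub_smul_one hz
  refine ⟨hA, hB, Ring.inverse_mul_eq_inverse_mul_of_mul_eq hA hB ?_ ?_⟩
  · have hK : cfc (fun t : ℝ => t * τ t) H * cfc θ H = H * cfc θ H := by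
      rw [← cfc_mul (fun t : ℝ => t * τ t) θ H (by fun_prop) (by fun_prop)]
      simp only [mul_assoc, hτθ]
      rw [cfc_mul (fun t : ℝ => t) θ H (by fun_prop) (by fun_prop), cfc_id' ℝ H]
    rw [sub_mul, sub_mul, hK]
  · exact (cfc_commute_cfc _ _ H).sub_left ((Commute.one_left _).smul_left z)
end

section
/- There exists a function χ ∈ C_c^∞(ℝ; ℝ) with 0 ≤ χ ≤ 1, χ = 1 on [−1, 1] and supp χ ⊆ [−2, 2], such that, writing χ̃ := 1 − χ and χ̃₊ := χ̃·𝟙_{[0,∞)}, χ̃₋ := χ̃·𝟙_{(−∞,0]}, the functions χ̃₊ and χ̃₋ are smooth and there exist smooth functions p₊, p₋, q₊, q₋ : ℝ → ℝ with χ̃₊ = p₊², χ̃₋ = p₋², χ̃₊' = q₊², and −χ̃₋' = q₋². (That is, one can choose the cut-off χ so that each half χ̃_σ of 1 − χ, as well as σ·χ̃_σ', is the square of a smooth function.) -/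
theorem expNegInvGlue.hasDerivAt (x : ℝ) :
    HasDerivAt expNegInvGlue (x⁻¹ ^ 2 * expNegInvGlue x) x := by
  simpa using expNegInvGlue.hasDerivAt_polynomial_eval_inv_mul 1 x

theorem expNegInvGlue.eq_sq (x : ℝ) : expNegInvGlue x = expNegInvGlue (2 * x) ^ 2 := by
  rcases le_or_gt x 0 with hx | hx
  · rw [expNegInvGlue.zero_of_nonpos hx, expNegInvGlue.zero_of_nonpos (by linarith)]
    norm_num
  · have h2 : ¬ 2 * x ≤ 0 := by linarith
    rw [expNegInvGlue, expNegInvGlue, if_neg hx.not_ge, if_neg h2, ← Real.exp_nat_mul]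
    congr 1
    push_cast
    field_simp

theorem expNegInvGlue.contDiff_inv_mul :
    ContDiff ℝ (⊤ : ℕ∞) fun x : ℝ => x⁻¹ * expNegInvGlue x := by
  simpa using expNegInvGlue.contDiff_polynomial_eval_inv_mul (n := ⊤) Polynomial.X

/-- A smooth square root of the derivative of `Real.smoothTransition ^ 2`. -/
noncomputable def sqrtDerivSmoothTransitionSq (x : ℝ) : ℝ :=
  (x⁻¹ * expNegInvGlue x) * (2 * ((2 * (1 - x))⁻¹ * expNegInvGlue (2 * (1 - x)))) *
    √(2 * (x ^ 2 + (1 - x) ^ 2) / (expNegInvGlue x + expNegInvGlue (1 - x)) ^ 3)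

theorem contDiff_sqrtDerivSmoothTransitionSq :
    ContDiff ℝ (⊤ : ℕ∞) sqrtDerivSmoothTransitionSq := by
  have hpos : ∀ x : ℝ, 0 < x ^ 2 + (1 - x) ^ 2 := fun x => by nlinarith [sq_nonneg (2 * x - 1)]
  have hden : ContDiff ℝ (⊤ : ℕ∞) fun x : ℝ => expNegInvGlue x + expNegInvGlue (1 - x) :=
    expNegInvGlue.contDiff.add (expNegInvGlue.contDiff.comp (contDiff_const.sub contDiff_id))
  have hlin : ContDiff ℝ (⊤ : ℕ∞) fun x : ℝ => 2 * (1 - x) := by fun_prop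
  refine (expNegInvGlue.contDiff_inv_mul.mul
    (contDiff_const.mul (expNegInvGlue.contDiff_inv_mul.comp hlin))).mul (ContDiff.sqrt ?_ ?_)
  · exact ContDiff.div (by fun_prop) (hden.pow 3)
      fun x => (pow_pos (Real.smoothTransition.pos_denom x) 3).ne'
  · intro x
    have h1 := hpos x
    have h2 := Real.smoothTransition.pos_denom x
    positivity

theorem hasDerivAt_smoothTransition_sq (x : ℝ) :
    HasDerivAt (fun y => Real.smoothTransition y ^ 2) (sqrtDerivSmoothTransitionSq x ^ 2) x := by
  have hd := Real.smoothTransition.pos_denom x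
  have hb : HasDerivAt (fun y : ℝ => expNegInvGlue (1 - y))
      (-((1 - x)⁻¹ ^ 2 * expNegInvGlue (1 - x))) x := by
    simpa [Function.comp_def] using (expNegInvGlue.hasDerivAt (1 - x)).comp x
      ((hasDerivAt_id x).const_sub 1)
  have ha := expNegInvGlue.hasDerivAt x
  have h := (ha.div (ha.add hb) hd.ne').pow 2
  refine h.congr_deriv ?_
  have hs : 0 ≤ 2 * (x ^ 2 + (1 - x) ^ 2) / (expNegInvGlue x + expNegInvGlue (1 - x)) ^ 3 := by
    positivity
  rw [sqrtDerivSmoothTransitionSq, mul_pow, Real.sq_sqrt hs]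
  have he := expNegInvGlue.eq_sq (1 - x)
  rcases eq_or_ne x 0 with rfl | hx0
  · simp
  rcases eq_or_ne (1 - x) 0 with hx1 | hx1
  · have : x = 1 := by linarith
    subst this
    simp
  simp only [Pi.add_apply, Pi.div_apply, Nat.cast_ofNat, Nat.add_one_sub_one, pow_one]
  generalize expNegInvGlue (2 * (1 - x)) = c at *
  rw [he] at hd ⊢
  generalize expNegInvGlue x = a at *
  generalize hy : 1 - x = y at *
  have hd' := hd.ne'
  field_simp
  ring

/-- There is a cut-off `χ ∈ C_c^∞(ℝ; ℝ)` with `0 ≤ χ ≤ 1`,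
`χ = 1` on `[−1, 1]` and `supp χ ⊆ [−2, 2]`, such that, writing `χ̃ = 1 − χ`,
`χ̃₊ = χ̃ · 𝟙_{[0,∞)}` and `χ̃₋ = χ̃ · 𝟙_{(−∞,0]}`, the functions `χ̃₊, χ̃₋` are
smooth, `χ̃₊`, `χ̃₋`, `χ̃₊'` and `−χ̃₋'` being squares of smooth functions. -/
theorem exists_good_cutoff :
    ∃ χ : ℝ → ℝ, ContDiff ℝ (⊤ : ℕ∞) χ ∧ HasCompactSupport χ ∧
      (∀ x, 0 ≤ χ x) ∧ (∀ x, χ x ≤ 1) ∧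
      (∀ x ∈ Set.Icc (-1 : ℝ) 1, χ x = 1) ∧
      tsupport χ ⊆ Set.Icc (-2 : ℝ) 2 ∧
      ContDiff ℝ (⊤ : ℕ∞)
        (Set.indicator (Set.Ici (0 : ℝ)) (fun x => 1 - χ x)) ∧
      ContDiff ℝ (⊤ : ℕ∞)
        (Set.indicator (Set.Iic (0 : ℝ)) (fun x => 1 - χ x)) ∧
      ∃ pp pm qp qm : ℝ → ℝ,
        ContDiff ℝ (⊤ : ℕ∞) pp ∧ ContDiff ℝ (⊤ : ℕ∞) pm ∧
        ContDiff ℝ (⊤ : ℕ∞) qp ∧ ContDiff ℝ (⊤ : ℕ∞) qm ∧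
        (∀ x, Set.indicator (Set.Ici (0 : ℝ)) (fun x => 1 - χ x) x = (pp x) ^ 2) ∧
        (∀ x, Set.indicator (Set.Iic (0 : ℝ)) (fun x => 1 - χ x) x = (pm x) ^ 2) ∧
        (∀ x, deriv (Set.indicator (Set.Ici (0 : ℝ)) (fun x => 1 - χ x)) x
          = (qp x) ^ 2) ∧
        (∀ x, -deriv (Set.indicator (Set.Iic (0 : ℝ)) (fun x => 1 - χ x)) x
          = (qm x) ^ 2) := by
  have hG : ContDiff ℝ (⊤ : ℕ∞) Real.smoothTransition := Real.smoothTransition.contDiff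
  have hshift : ContDiff ℝ (⊤ : ℕ∞) fun x : ℝ => x - 1 := by fun_prop
  have hrefl : ContDiff ℝ (⊤ : ℕ∞) fun x : ℝ => -x - 1 := by fun_prop
  have hzero : ∀ y : ℝ, y ≤ 0 → Real.smoothTransition y = 0 :=
    fun y hy => Real.smoothTransition.zero_of_nonpos hy
  have hone : ∀ y : ℝ, 1 ≤ y → Real.smoothTransition y = 1 :=
    fun y hy => Real.smoothTransition.one_of_one_le hy
  have hle : ∀ y : ℝ, Real.smoothTransition y ^ 2 ≤ 1 := fun y =>
    pow_le_one₀ (Real.smoothTransition.nonneg y) (Real.smoothTransition.le_one y)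
  let χ : ℝ → ℝ := fun x =>
    1 - Real.smoothTransition (x - 1) ^ 2 - Real.smoothTransition (-x - 1) ^ 2
  have hp : Set.indicator (Set.Ici (0 : ℝ)) (fun x => 1 - χ x) =
      fun x => Real.smoothTransition (x - 1) ^ 2 := by
    funext x
    rcases le_or_gt 0 x with hx | hx
    · rw [Set.indicator_of_mem (Set.mem_Ici.2 hx)]
      simp [χ, hzero (-x - 1) (by linarith)]
    · rw [Set.indicator_of_notMem (by simpa using hx)]
      simp [hzero (x - 1) (by linarith)]
  have hm : Set.indicator (Set.Iic (0 : ℝ)) (fun x => 1 - χ x) =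
      fun x => Real.smoothTransition (-x - 1) ^ 2 := by
    funext x
    rcases le_or_gt x 0 with hx | hx
    · rw [Set.indicator_of_mem (Set.mem_Iic.2 hx)]
      simp [χ, hzero (x - 1) (by linarith)]
    · rw [Set.indicator_of_notMem (by simpa using hx)]
      simp [hzero (-x - 1) (by linarith)]
  have hsupp : tsupport χ ⊆ Set.Icc (-2 : ℝ) 2 := by
    refine closure_minimal (fun x hx => ?_) isClosed_Icc
    by_contra hmem
    refine hx ?_
    rw [Set.mem_Icc, not_and_or, not_le, not_le] at hmem
    rcases hmem with h | h
    · simp [χ, hzero (x - 1) (by linarith), hone (-x - 1) (by linarith)]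
    · simp [χ, hzero (-x - 1) (by linarith), hone (x - 1) (by linarith)]
  refine ⟨χ, (contDiff_const.sub ((hG.comp hshift).pow 2)).sub ((hG.comp hrefl).pow 2),
    isCompact_Icc.of_isClosed_subset (isClosed_tsupport χ) hsupp, fun x => ?_, fun x => ?_,
    fun x hx => ?_, hsupp, ?_⟩
  · rcases le_total x 0 with hx | hx
    · simpa [χ, hzero (x - 1) (by linarith)] using hle (-x - 1)
    · simpa [χ, hzero (-x - 1) (by linarith)] using hle (x - 1)
  · have h1 := sq_nonneg (Real.smoothTransition (x - 1))
    have h2 := sq_nonneg (Real.smoothTransition (-x - 1))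
    simp only [χ]
    linarith
  · simp [χ, hzero (x - 1) (by linarith [hx.2]), hzero (-x - 1) (by linarith [hx.1])]
  rw [hp, hm]
  refine ⟨(hG.comp hshift).pow 2, (hG.comp hrefl).pow 2,
    fun x => Real.smoothTransition (x - 1), fun x => Real.smoothTransition (-x - 1),
    fun x => sqrtDerivSmoothTransitionSq (x - 1), fun x => sqrtDerivSmoothTransitionSq (-x - 1),
    hG.comp hshift, hG.comp hrefl, contDiff_sqrtDerivSmoothTransitionSq.comp hshift,
    contDiff_sqrtDerivSmoothTransitionSq.comp hrefl, fun _ => rfl, fun _ => rfl,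
    fun x => ?_, fun x => ?_⟩
  · have h := (hasDerivAt_smoothTransition_sq (x - 1)).comp x ((hasDerivAt_id x).sub_const 1)
    simpa [Function.comp_def] using h.deriv
  · have h := (hasDerivAt_smoothTransition_sq (-x - 1)).comp x
      ((hasDerivAt_id x).neg.sub_const 1)
    rw [neg_eq_iff_eq_neg]
    simpa [Function.comp_def] using h.deriv
end
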